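/- Let β₃₁, β₂₃, β₀₂ ∈ K be such that the plane sextic C : X⁶ + XY⁵ + XZ⁵ + β₃₁X³YZ² + β₂₃X²Y³Z + β₀₂Y²Z⁴ = 0 is smooth and such that every element of Aut(C) ⊂ PGL₃(K) has order at most 5. Then Aut(C) is cyclic of order 5, generated by σ = diag(1, ζ₅, ζ₅²). -/

import Mathlib

open MvPolynomial

/-- `GL₃(K)`: the group of invertible `3 × 3` matrices over `K`. -/
abbrev GL3 (K : Type*) [Field K] := (Matrix (Fin 3) (Fin 3) K)ˣ

/-- `PGL₃(K)`: the quotient of `GL₃(K)` by its center (the scalar matrices). -/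
abbrev PGL3 (K : Type*) [Field K] := GL3 K ⧸ Subgroup.center (GL3 K)

variable {K : Type*} [Field K]

/-- The substitution `F(X,Y,Z) ↦ F(A·(X,Y,Z)ᵗ)` for a `3 × 3` matrix `A`. -/
noncomputable def matAct (A : Matrix (Fin 3) (Fin 3) K) (F : MvPolynomial (Fin 3) K) :
    MvPolynomial (Fin 3) K :=
  aeval (fun i => ∑ j, C (A i j) * X j) F

lemma matAct_one (F : MvPolynomial (Fin 3) K) : matAct 1 F = F := by
  unfold matAct
  have h : (fun i => ∑ j, C ((1 : Matrix (Fin 3) (Fin 3) K) i j) * X j)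
      = (X : Fin 3 → MvPolynomial (Fin 3) K) := by
    funext i
    rw [Finset.sum_eq_single i]
    · simp
    · intro b _ hb
      simp [Matrix.one_apply, Ne.symm hb]
    · simp
  rw [h, aeval_X_left_apply]

lemma matAct_matAct (A B : Matrix (Fin 3) (Fin 3) K) (F : MvPolynomial (Fin 3) K) :
    matAct B (matAct A F) = matAct (A * B) F := by
  unfold matAct
  rw [← AlgHom.comp_apply, comp_aeval]
  have h : (fun i => (aeval fun i => ∑ j, C (B i j) * X j) (∑ j, C (A i j) * X j))
      = fun i => ∑ j : Fin 3, C ((A * B) i j) * (X j : MvPolynomial (Fin 3) K) := by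
    funext i
    simp only [map_sum, map_mul, aeval_C, aeval_X, algebraMap_eq, Finset.mul_sum]
    rw [Finset.sum_comm]
    refine Finset.sum_congr rfl fun k _ => ?_
    rw [Matrix.mul_apply, map_sum, Finset.sum_mul]
    refine Finset.sum_congr rfl fun j _ => ?_
    rw [map_mul, mul_assoc]
  rw [h]

lemma matAct_smul (A : Matrix (Fin 3) (Fin 3) K) (c : K) (F : MvPolynomial (Fin 3) K) :
    matAct A (c • F) = c • matAct A F :=
  map_smul (aeval fun i => ∑ j, C (A i j) * X j) c F

/-- The class of a matrix `A` in `PGL₃(K)` (junk value `1` if `A` is not invertible). -/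
noncomputable def pgl (A : Matrix (Fin 3) (Fin 3) K) : PGL3 K := by
  classical
  exact if h : IsUnit A then (QuotientGroup.mk h.unit : PGL3 K) else 1

/-- `F` defines a smooth plane sextic: `F` is homogeneous of degree `6`, and `F` together with
its partial derivatives have no common zero besides the origin. -/
def IsSmoothSextic (F : MvPolynomial (Fin 3) K) : Prop :=
  F.IsHomogeneous 6 ∧
    ∀ p : Fin 3 → K, eval p F = 0 → (∀ i, eval p (pderiv i F) = 0) → p = 0

/-- The automorphism group of the plane curve `F = 0`: the subgroup of `PGL₃(K)` consisting of
the classes of matrices `A ∈ GL₃(K)` with `F(A·(X,Y,Z)ᵗ) = λ·F(X,Y,Z)` for some `λ ∈ K×`. -/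
noncomputable def planeAut (F : MvPolynomial (Fin 3) K) : Subgroup (PGL3 K) where
  carrier := {g | ∃ A : GL3 K, (QuotientGroup.mk A : PGL3 K) = g ∧
    ∃ c : K, c ≠ 0 ∧ matAct (A : Matrix (Fin 3) (Fin 3) K) F = c • F}
  one_mem' := ⟨1, rfl, 1, one_ne_zero, by rw [Units.val_one, matAct_one, one_smul]⟩
  mul_mem' := by
    rintro g h ⟨A, rfl, c, hc, hA⟩ ⟨B, rfl, d, hd, hB⟩
    exact ⟨A * B, rfl, c * d, mul_ne_zero hc hd, by
      rw [Units.val_mul, ← matAct_matAct, hA, matAct_smul, hB, smul_smul]⟩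
  inv_mem' := by
    rintro g ⟨A, rfl, c, hc, hA⟩
    refine ⟨A⁻¹, rfl, c⁻¹, inv_ne_zero hc, ?_⟩
    rw [eq_inv_smul_iff₀ hc, ← matAct_smul, ← hA, matAct_matAct, ← Units.val_mul,
      mul_inv_cancel, Units.val_one, matAct_one]

lemma eval_smul_of_isHomogeneous {F : MvPolynomial (Fin 3) K} {n : ℕ} (hF : F.IsHomogeneous n)
    (c : K) (x : Fin 3 → K) : eval (c • x) F = c ^ n * eval x F := by
  rw [eval_eq, eval_eq, Finset.mul_sum]
  refine Finset.sum_congr rfl fun d hd => ?_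
  have h : ∑ i ∈ d.support, d i = n := by
    simpa [Finsupp.weight_apply, Finsupp.sum] using hF (mem_support_iff.mp hd)
  simp only [Pi.smul_apply, smul_eq_mul, mul_pow, Finset.prod_mul_distrib, Finset.prod_pow_eq_pow_sum,
    h]
  ring

/-- The restriction `t ↦ F(x + t y)` of a polynomial to a parametrized line. -/
noncomputable def lineRestrict (F : MvPolynomial (Fin 3) K) (x y : Fin 3 → K) : Polynomial K :=
  aeval (fun i => Polynomial.C (x i) + Polynomial.C (y i) * Polynomial.X) F

lemma eval_lineRestrict (F : MvPolynomial (Fin 3) K) (x y : Fin 3 → K) (t : K) :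
    (lineRestrict F x y).eval t = eval (x + t • y) F := by
  unfold lineRestrict
  induction F using MvPolynomial.induction_on with
  | C a => simp
  | add p q hp hq => simp [hp, hq]
  | mul_X p i hp => simp [hp, mul_comm t]

/-- The differential of `F` at the point `x`, as a linear form. -/
noncomputable def differential (F : MvPolynomial (Fin 3) K) (x : Fin 3 → K) :
    (Fin 3 → K) →ₗ[K] K :=
  ∑ i, eval x (pderiv i F) • LinearMap.proj i

lemma differential_apply (F : MvPolynomial (Fin 3) K) (x y : Fin 3 → K) :
    differential F x y = ∑ i, eval x (pderiv i F) * y i := by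
  simp [differential, LinearMap.sum_apply]

lemma coeff_one_lineRestrict (F : MvPolynomial (Fin 3) K) (x y : Fin 3 → K) :
    (lineRestrict F x y).coeff 1 = differential F x y := by
  have h0 : ∀ p, (lineRestrict p x y).coeff 0 = eval x p := fun p => by
    rw [Polynomial.coeff_zero_eq_eval_zero, eval_lineRestrict]; simp
  rw [differential_apply]
  induction F using MvPolynomial.induction_on with
  | C a => simp [lineRestrict]
  | add p q hp hq =>
    have : lineRestrict (p + q) x y = lineRestrict p x y + lineRestrict q x y := map_add _ _ _
    simp [this, hp, hq, add_mul, Finset.sum_add_distrib]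
  | mul_X p i hp =>
    have h : lineRestrict (p * X i) x y
        = lineRestrict p x y * Polynomial.C (x i)
          + lineRestrict p x y * Polynomial.C (y i) * Polynomial.X := by
      simp [lineRestrict]; ring
    have h1 : (lineRestrict p x y * Polynomial.C (y i) * Polynomial.X).coeff 1
        = eval x p * y i := by
      rw [Polynomial.coeff_mul_X, Polynomial.coeff_mul_C, h0]
    rw [h, Polynomial.coeff_add, h1, Polynomial.coeff_mul_C, hp]
    have h2 : ∀ j, eval x (pderiv j (p * X i)) * y j
        = eval x (pderiv j p) * y j * x i + (if j = i then eval x p * y j else 0) := fun j => by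
      split_ifs with hj
      · simp [hj]; ring
      · simp [pderiv_X_of_ne (Ne.symm hj)]; ring
    rw [Finset.sum_congr rfl fun j _ => h2 j]
    simp [Finset.sum_add_distrib, Finset.sum_mul]

lemma eq_zero_of_differential_eq_zero [CharZero K] {F : MvPolynomial (Fin 3) K}
    (hF : IsSmoothSextic F) {x : Fin 3 → K} (h : ∀ y, differential F x y = 0) : x = 0 := by
  refine hF.2 x ?_ fun i => by simpa [differential_apply, Pi.single_apply] using h (Pi.single i 1)
  have e := congrArg (eval x) hF.1.sum_X_mul_pderiv
  have := h x
  simp only [differential_apply] at this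
  simp only [map_sum, map_mul, eval_X, map_nsmul, mul_comm (x _), this] at e
  simpa using e.symm

lemma differential_smul [Infinite K] {F : MvPolynomial (Fin 3) K} (hF : F.IsHomogeneous 6) (c : K)
    (hc : c ≠ 0) (x y : Fin 3 → K) : differential F (c • x) y = c ^ 5 * differential F x y := by
  have h : lineRestrict F (c • x) (c • y) = Polynomial.C (c ^ 6) * lineRestrict F x y := by
    refine Polynomial.funext fun t => ?_
    rw [Polynomial.eval_mul, Polynomial.eval_C, eval_lineRestrict, eval_lineRestrict,
      ← eval_smul_of_isHomogeneous hF, smul_add, smul_comm]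
  have h1 := congrArg (Polynomial.coeff · 1) h
  simp only [coeff_one_lineRestrict, Polynomial.coeff_C_mul, map_smul, smul_eq_mul] at h1
  refine mul_left_cancel₀ hc ?_
  rw [h1]; ring

/-- The endomorphism `T` of `K³` leaves the polynomial function `F` invariant. -/
def Preserves (T : Module.End K (Fin 3 → K)) (F : MvPolynomial (Fin 3) K) : Prop :=
  ∀ x, eval (T x) F = eval x F

lemma Preserves.mul {S T : Module.End K (Fin 3 → K)} {F : MvPolynomial (Fin 3) K}
    (hS : Preserves S F) (hT : Preserves T F) : Preserves (S * T) F :=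
  fun x => (hS (T x)).trans (hT x)

lemma Preserves.pow {T : Module.End K (Fin 3 → K)} {F : MvPolynomial (Fin 3) K}
    (hT : Preserves T F) : ∀ n : ℕ, Preserves (T ^ n) F
  | 0 => fun _ => rfl
  | n + 1 => by rw [pow_succ]; exact (hT.pow n).mul hT

lemma Preserves.smul {T : Module.End K (Fin 3 → K)} {F : MvPolynomial (Fin 3) K}
    (hF : F.IsHomogeneous 6) (hT : Preserves T F) {c : K} (hc : c ^ 6 = 1) :
    Preserves (c • T) F := fun x => by
  rw [LinearMap.smul_apply, eval_smul_of_isHomogeneous hF, hc, one_mul, hT x]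

lemma Preserves.differential_apply [Infinite K] {T : Module.End K (Fin 3 → K)}
    {F : MvPolynomial (Fin 3) K} (hT : Preserves T F) (x y : Fin 3 → K) :
    differential F (T x) (T y) = differential F x y := by
  rw [← coeff_one_lineRestrict, ← coeff_one_lineRestrict]
  congr 1
  refine Polynomial.funext fun t => ?_
  rw [eval_lineRestrict, eval_lineRestrict, ← map_smul, ← map_add, hT]

/-- If a linear automorphism of a smooth sextic form has eigenvalue `a`, then the differential of
the form at an eigenvector is a left eigenvector of eigenvalue `a⁻⁵`. -/
lemma Preserves.differential_eigenvector [CharZero K] {T : Module.End K (Fin 3 → K)}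
    {F : MvPolynomial (Fin 3) K} (hF : F.IsHomogeneous 6) (hT : Preserves T F) {a : K} (ha : a ≠ 0)
    {v : Fin 3 → K} (hv : T v = a • v) (y : Fin 3 → K) :
    differential F v (T y) = (a ^ 5)⁻¹ * differential F v y := by
  have h := hT.differential_apply v y
  rw [hv, differential_smul hF a ha] at h
  rw [← h, inv_mul_cancel_left₀ (pow_ne_zero 5 ha)]

lemma Preserves.hasEigenvalue_inv_pow [CharZero K] {T : Module.End K (Fin 3 → K)}
    {F : MvPolynomial (Fin 3) K} (hF : IsSmoothSextic F) (hT : Preserves T F) {a : K} (ha : a ≠ 0)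
    (h : T.HasEigenvalue a) : T.HasEigenvalue (a ^ 5)⁻¹ := by
  obtain ⟨v, hv⟩ := h.exists_hasEigenvector
  rw [Module.End.hasEigenvalue_iff_mem_spectrum, spectrum.mem_iff]
  intro hu
  refine hv.2 (eq_zero_of_differential_eq_zero hF fun y => ?_)
  obtain ⟨z, rfl⟩ := ((Module.End.isUnit_iff _).mp hu).surjective y
  simp [hT.differential_eigenvector hF.1 ha hv.apply_eq_smul]

lemma isOfFinOrder_of_mapsTo_inv_pow {S : Set K} (hS : S.Finite) (h0 : (0 : K) ∉ S)
    (h : ∀ a ∈ S, (a ^ 5)⁻¹ ∈ S) {a : K} (ha : a ∈ S) : IsOfFinOrder a := by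
  have ha0 : a ≠ 0 := fun e => h0 (e ▸ ha)
  have hmem : ∀ n : ℕ, a ^ ((-5 : ℤ) ^ n) ∈ S := by
    intro n
    induction n with
    | zero => simpa using ha
    | succ n ih =>
      have := h _ ih
      rwa [← zpow_natCast, ← zpow_mul, ← zpow_neg, neg_mul_eq_mul_neg,
        show (-5 : ℤ) ^ n * -((5 : ℕ) : ℤ) = (-5) ^ (n + 1) by rw [pow_succ]; norm_num] at this
  have := hS.to_subtype
  obtain ⟨m, n, hmn, e⟩ :=
    Finite.exists_ne_map_eq_of_infinite fun n : ℕ => (⟨_, hmem n⟩ : S)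
  have e' : a ^ ((-5 : ℤ) ^ m) = a ^ ((-5 : ℤ) ^ n) := congrArg Subtype.val e
  have hne : ((-5 : ℤ) ^ m - (-5) ^ n) ≠ 0 := by
    rw [sub_ne_zero]
    intro h5
    have := congrArg Int.natAbs h5
    simp only [Int.natAbs_pow] at this
    exact hmn (Nat.pow_right_injective (by norm_num) this)
  refine isOfFinOrder_iff_pow_eq_one.mpr ⟨((-5 : ℤ) ^ m - (-5) ^ n).natAbs,
    Int.natAbs_pos.mpr hne, ?_⟩
  have h1 : a ^ ((-5 : ℤ) ^ m - (-5) ^ n) = 1 := by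
    rw [zpow_sub₀ ha0, e', div_self (zpow_ne_zero _ ha0)]
  rw [← zpow_natCast]
  rcases Int.natAbs_eq ((-5 : ℤ) ^ m - (-5) ^ n) with hh | hh
  · rwa [← hh]
  · rw [← inv_inj, ← zpow_neg, ← hh, h1, inv_one]

open scoped Pointwise in
/-- A linear automorphism of a smooth sextic form is quasi-unipotent. -/
lemma Preserves.exists_pow_eq_one_add_nilpotent [IsAlgClosed K] [CharZero K]
    {T : Module.End K (Fin 3 → K)} {F : MvPolynomial (Fin 3) K} (hF : IsSmoothSextic F)
    (hT : Preserves T F) (hu : IsUnit T) : ∃ n : ℕ, 0 < n ∧ IsNilpotent (T ^ n - 1) := by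
  have hfin : (spectrum K T).Finite := by
    refine (Module.End.finite_hasEigenvalue T).subset fun a ha => ?_
    exact Module.End.hasEigenvalue_iff_mem_spectrum.mpr ha
  have h0 : (0 : K) ∉ spectrum K T := spectrum.zero_notMem K hu
  have hord : ∀ a ∈ spectrum K T, IsOfFinOrder a := fun a ha =>
    isOfFinOrder_of_mapsTo_inv_pow hfin h0 (fun b hb => by
      rw [← Module.End.hasEigenvalue_iff_mem_spectrum] at hb ⊢
      refine hT.hasEigenvalue_inv_pow hF ?_ hb
      rintro rfl
      exact h0 (Module.End.hasEigenvalue_iff_mem_spectrum.mp hb)) ha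
  set n := ∏ a ∈ hfin.toFinset, orderOf a with hn
  have hpos : 0 < n := Finset.prod_pos fun a ha => (hord a (hfin.mem_toFinset.mp ha)).orderOf_pos
  refine ⟨n, hpos, ?_⟩
  have hspec : ∀ b : K, (T ^ n - 1).HasEigenvalue b → b = 0 := by
    intro b hb
    have hb' : b ∈ spectrum K (T ^ n) - ({1} : Set K) := by
      rw [spectrum.sub_singleton_eq, map_one]
      exact Module.End.hasEigenvalue_iff_mem_spectrum.mp hb
    obtain ⟨c, hc, _, rfl, rfl⟩ := hb'
    rw [spectrum.map_pow_of_pos T hpos] at hc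
    obtain ⟨a, ha, rfl⟩ := hc
    refine sub_eq_zero.mpr (orderOf_dvd_iff_pow_eq_one.mp ?_)
    exact Finset.dvd_prod_of_mem _ (hfin.mem_toFinset.mpr ha)
  have htop : (T ^ n - 1).maxGenEigenspace 0 = ⊤ := by
    rw [eq_top_iff, ← Module.End.iSup_maxGenEigenspace_eq_top (T ^ n - 1), iSup_le_iff]
    intro b
    by_cases hb : (T ^ n - 1).HasEigenvalue b
    · rw [hspec b hb]
    · have : (T ^ n - 1).maxGenEigenspace b = ⊥ := by
        by_contra hne
        exact hb (Module.End.HasUnifEigenvalue.lt zero_lt_one hne)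
      simp [this]
  refine ((LinearMap.charpoly_nilpotent_tfae (T ^ n - 1)).out 0 2).mpr fun x => ?_
  have hx : x ∈ (T ^ n - 1).maxGenEigenspace 0 := htop ▸ Submodule.mem_top
  simpa [Module.End.mem_maxGenEigenspace] using hx

lemma one_add_pow_of_cube_eq_zero {A : Type*} [Ring A] [Algebra K A] [CharZero K] {N : A}
    (hN : N ^ 3 = 0) (n : ℕ) :
    (1 + N) ^ n = 1 + (n : K) • (N - (2⁻¹ : K) • N ^ 2) + ((n : K) ^ 2 / 2) • N ^ 2 := by
  induction n with
  | zero => simp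
  | succ n ih =>
    have h3 : N ^ 2 * N = 0 := by rw [← pow_succ, hN]
    rw [pow_succ, ih]
    simp only [mul_add, add_mul, sub_mul, smul_mul_assoc, one_mul, mul_one, h3, smul_zero, sub_zero,
      add_zero, ← sq, smul_sub]
    push_cast
    module

lemma finrank_range_le_one_of_sq_eq_zero {N : Module.End K (Fin 3 → K)} (hN : N ^ 2 = 0) :
    Module.finrank K (LinearMap.range N) ≤ 1 := by
  have h1 : LinearMap.range N ≤ LinearMap.ker N := by
    rintro _ ⟨x, rfl⟩
    rw [LinearMap.mem_ker, ← Module.End.mul_apply, ← sq, hN, LinearMap.zero_apply]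
  have h2 := Submodule.finrank_mono h1
  have h3 := LinearMap.finrank_range_add_finrank_ker N
  rw [Module.finrank_fin_fun] at h3
  omega

lemma infinite_range_inv_natCast_succ [CharZero K] :
    (Set.range fun n : ℕ => ((n : K) + 1)⁻¹).Infinite :=
  Set.infinite_range_of_injective fun m n h => by simpa using h

lemma Preserves.eq_one_of_sub_one_sq_eq_zero [CharZero K] {T : Module.End K (Fin 3 → K)}
    {F : MvPolynomial (Fin 3) K} (hF : IsSmoothSextic F) (hT : Preserves T F)
    (hN : (T - 1) ^ 2 = 0) : T = 1 := by
  set N := T - 1 with hNdef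
  by_contra hne
  have hpow : ∀ (n : ℕ) y, (T ^ n) y = y + (n : K) • N y := fun n y => by
    have := one_add_pow_of_cube_eq_zero (K := K) (by rw [pow_succ, hN, zero_mul] : N ^ 3 = 0) n
    rw [hNdef, add_sub_cancel, ← hNdef, hN] at this
    simp [this]
  have hd : ∀ y, differential F (N y) y = 0 := by
    intro y
    have h : lineRestrict F (N y) y = Polynomial.C (eval y F) * Polynomial.X ^ 6 := by
      refine Polynomial.eq_of_infinite_eval_eq _ _ (infinite_range_inv_natCast_succ.mono ?_)
      rintro _ ⟨n, rfl⟩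
      have hn : (n : K) + 1 ≠ 0 := Nat.cast_add_one_ne_zero n
      have e : N y + ((n : K) + 1)⁻¹ • y = ((n : K) + 1)⁻¹ • (T ^ (n + 1)) y := by
        rw [hpow, smul_add, smul_smul, add_comm]
        push_cast
        rw [inv_mul_cancel₀ hn, one_smul]
      simp only [Set.mem_ofPred_eq, eval_lineRestrict, e, eval_smul_of_isHomogeneous hF.1,
        hT.pow (n + 1) y, Polynomial.eval_mul, Polynomial.eval_C, Polynomial.eval_pow,
        Polynomial.eval_X, mul_comm]
    rw [← coeff_one_lineRestrict, h, Polynomial.coeff_C_mul, Polynomial.coeff_X_pow]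
    simp
  obtain ⟨x, hx⟩ : ∃ x, N x ≠ 0 := by
    by_contra! h
    exact hne (sub_eq_zero.mp (LinearMap.ext h))
  obtain ⟨v, hv⟩ := finrank_le_one_iff.mp (finrank_range_le_one_of_sq_eq_zero hN)
  have hker : ∀ z, N z = 0 → differential F (N x) z = 0 := by
    intro z hz
    have := hd (x + z)
    rwa [map_add N, hz, add_zero, map_add, hd x, zero_add] at this
  refine hx (eq_zero_of_differential_eq_zero hF fun y => ?_)
  obtain ⟨a, ha⟩ := hv ⟨N x, x, rfl⟩
  obtain ⟨b, hb⟩ := hv ⟨N y, y, rfl⟩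
  rw [Subtype.ext_iff] at ha hb
  simp only [Submodule.coe_smul] at ha hb
  have ha0 : a ≠ 0 := by rintro rfl; exact hx (by rw [← ha, zero_smul])
  have := hker (y - (b / a) • x) (by
    rw [map_sub, map_smul, ← ha, ← hb, smul_smul, div_mul_cancel₀ _ ha0, sub_self])
  rwa [map_sub, map_smul, hd, smul_zero, sub_zero] at this

lemma Preserves.sub_one_sq_eq_zero [CharZero K] {T : Module.End K (Fin 3 → K)}
    {F : MvPolynomial (Fin 3) K} (hF : IsSmoothSextic F) (hT : Preserves T F)
    (hN : (T - 1) ^ 3 = 0) : (T - 1) ^ 2 = 0 := by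
  set N := T - 1 with hNdef
  by_contra hne
  obtain ⟨x, hx⟩ : ∃ x, (N ^ 2) x ≠ 0 := by
    by_contra! h
    exact hne (LinearMap.ext h)
  set L := N - (2⁻¹ : K) • N ^ 2 with hL
  have hpow : ∀ (n : ℕ) y, (T ^ n) y = y + (n : K) • L y + ((n : K) ^ 2 / 2) • (N ^ 2) y :=
    fun n y => by
      have := one_add_pow_of_cube_eq_zero (K := K) hN n
      rw [hNdef, add_sub_cancel, ← hNdef] at this
      simp [this, hL]
  have hN4 : N * N ^ 2 = 0 := by rw [← pow_succ', hN]
  have hN5 : N ^ 2 * N ^ 2 = 0 := by rw [← pow_add, pow_succ, hN, zero_mul]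
  have hLL : L * L = N ^ 2 := by
    rw [hL]
    simp only [mul_sub, sub_mul, smul_mul_assoc, mul_smul_comm, hN4, hN5, ← pow_succ, hN]
    simp [sq]
  have hLx : L (L x) = (N ^ 2) x := by rw [← Module.End.mul_apply, hLL]
  have hNL : (N ^ 2) (L x) = 0 := by
    rw [← Module.End.mul_apply, hL, mul_sub, mul_smul_comm, hN5, ← pow_succ, hN]
    simp
  have hd : differential F ((N ^ 2) x) x = 0 := by
    have h : Polynomial.expand K 2
        ((lineRestrict F ((N ^ 2) x) x).comp (Polynomial.C (-2) * Polynomial.X))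
        = Polynomial.C 64 * lineRestrict F (L x) (-x) * Polynomial.X ^ 6 := by
      refine Polynomial.eq_of_infinite_eval_eq _ _ (infinite_range_inv_natCast_succ.mono ?_)
      rintro _ ⟨n, rfl⟩
      have hn : (n : K) + 1 ≠ 0 := Nat.cast_add_one_ne_zero n
      have e : (N ^ 2) x + (-2 * (((n : K) + 1)⁻¹) ^ 2) • x
          = (2 * ((n : K) + 1)⁻¹) • (T ^ (n + 1)) (L x + ((n : K) + 1)⁻¹ • -x) := by
        rw [hpow]
        simp only [map_add, map_smul, map_neg, hLx, hNL]
        push_cast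
        match_scalars <;> field_simp <;> ring
      simp only [Set.mem_ofPred_eq, Polynomial.expand_eval, Polynomial.eval_comp, eval_lineRestrict,
        Polynomial.eval_mul, Polynomial.eval_C, Polynomial.eval_X, Polynomial.eval_pow, e,
        eval_smul_of_isHomogeneous hF.1, hT.pow (n + 1) _]
      ring
    have h1 := congrArg (Polynomial.coeff · 2) h
    simp only [Polynomial.coeff_mul_X_pow', Polynomial.coeff_expand (by norm_num : 0 < 2)] at h1
    norm_num [coeff_one_lineRestrict, Polynomial.comp_C_mul_X_coeff, -map_neg] at h1
    exact h1
  have hfix : T ((N ^ 2) x) = (1 : K) • (N ^ 2) x := by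
    rw [one_smul]
    exact sub_eq_zero.mp (LinearMap.congr_fun hN4 x)
  have hdN : ∀ y, differential F ((N ^ 2) x) (N y) = 0 := fun y => by
    have := hT.differential_eigenvector hF.1 one_ne_zero hfix y
    rw [hNdef, LinearMap.sub_apply, map_sub, ← hNdef, this]
    simp
  have hli : LinearIndependent K ![x, N x, (N ^ 2) x] := by
    rw [Fintype.linearIndependent_iff]
    intro g hg
    simp only [Fin.sum_univ_three, Matrix.cons_val_zero, Matrix.cons_val_one,
      Matrix.cons_val] at hg
    have h3 : ∀ y, N ((N ^ 2) y) = 0 := LinearMap.congr_fun hN4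
    have h2 : ∀ y, N (N y) = (N ^ 2) y := fun y => by rw [sq]; rfl
    have g0 : g 0 = 0 := by
      have := congrArg (⇑(N ^ 2)) hg
      simp only [map_add, map_smul, map_zero, ← h2] at this
      simp only [h2, h3] at this
      simpa [hx] using this
    have g1 : g 1 = 0 := by
      have := congrArg (⇑N) hg
      simp only [map_add, map_smul, map_zero, h2, h3, g0] at this
      simpa [hx] using this
    have g2 : g 2 = 0 := by simpa [g0, g1, hx] using hg
    intro i
    fin_cases i <;> assumption
  refine hx (eq_zero_of_differential_eq_zero hF fun y => ?_)
  have hspan := hli.span_eq_top_of_card_eq_finrank (by simp)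
  have : differential F ((N ^ 2) x) = 0 := by
    refine LinearMap.ext_on hspan ?_
    rintro _ ⟨i, rfl⟩
    fin_cases i
    · simpa using hd
    · simpa using hdN x
    · simpa [sq] using hdN (N x)
  simp [this]

/-- A linear automorphism of a smooth sextic form has finite order. -/
lemma Preserves.exists_pow_eq_one [IsAlgClosed K] [CharZero K]
    {T : Module.End K (Fin 3 → K)} {F : MvPolynomial (Fin 3) K} (hF : IsSmoothSextic F)
    (hT : Preserves T F) (hu : IsUnit T) : ∃ n : ℕ, 0 < n ∧ T ^ n = 1 := by
  obtain ⟨n, hn, hnil⟩ := hT.exists_pow_eq_one_add_nilpotent hF hu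
  refine ⟨n, hn, (hT.pow n).eq_one_of_sub_one_sq_eq_zero hF
    ((hT.pow n).sub_one_sq_eq_zero hF ?_)⟩
  have := LinearMap.isNilpotent_iff_charpoly _ |>.mp hnil
  have h := (T ^ n - 1).aeval_self_charpoly
  rwa [this, Module.finrank_fin_fun, map_pow, Polynomial.aeval_X] at h

/-- A binary form over an algebraically closed field has a nontrivial zero. -/
lemma exists_eval_smul_add_smul_eq_zero [IsAlgClosed K] {H : MvPolynomial (Fin 3) K} {n : ℕ}
    (hH : H.IsHomogeneous n) (hn : n ≠ 0) (x y : Fin 3 → K) :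
    ∃ a b : K, (a ≠ 0 ∨ b ≠ 0) ∧ eval (a • x + b • y) H = 0 := by
  by_cases hdeg : (lineRestrict H x y).degree = 0
  · obtain ⟨c, hc⟩ : ∃ c, lineRestrict H x y = Polynomial.C c :=
      ⟨_, Polynomial.eq_C_of_degree_eq_zero hdeg⟩
    have h : lineRestrict H y x = Polynomial.C c * Polynomial.X ^ n := by
      refine Polynomial.eq_of_infinite_eval_eq _ _
        ((Set.finite_singleton (0 : K)).infinite_compl.mono fun t ht => ?_)
      have ht0 : t ≠ 0 := ht
      have e : y + t • x = t • (x + t⁻¹ • y) := by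
        rw [smul_add, smul_smul, mul_inv_cancel₀ ht0, one_smul, add_comm]
      rw [Set.mem_ofPred_eq, eval_lineRestrict, e, eval_smul_of_isHomogeneous hH,
        ← eval_lineRestrict, hc]
      simp only [Polynomial.eval_mul, Polynomial.eval_C, Polynomial.eval_pow, Polynomial.eval_X]
      ring
    refine ⟨0, 1, Or.inr one_ne_zero, ?_⟩
    have := congrArg (Polynomial.eval 0) h
    simpa [eval_lineRestrict, hn] using this
  · obtain ⟨t, ht⟩ := IsAlgClosed.exists_root _ hdeg
    refine ⟨1, t, Or.inl one_ne_zero, ?_⟩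
    rwa [Polynomial.IsRoot, eval_lineRestrict, ← one_smul K x] at ht

lemma exists_basis_eigenvectors_of_pow_eq_smul_one [IsAlgClosed K] [CharZero K]
    {T : Module.End K (Fin 3 → K)} {m : ℕ} (hm : m ≠ 0) {s : K} (hs : s ≠ 0)
    (hT : T ^ m = s • 1) :
    ∃ (b : Module.Basis (Fin 3) K (Fin 3 → K)) (a : Fin 3 → K),
      (∀ i, T (b i) = a i • b i) ∧ ∀ i, a i ^ m = s := by
  have hss : T.IsSemisimple := by
    refine Module.End.isSemisimple_of_squarefree_aeval_eq_zero
      (Polynomial.separable_X_pow_sub_C s (Nat.cast_ne_zero.mpr hm) hs).squarefree ?_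
    simp [hT, Algebra.algebraMap_eq_smul_one]
  have hspan : ⊤ ≤ Submodule.span K {v | ∃ a : K, T v = a • v} := by
    rw [← hss.iSup_eigenspace_eq_top, iSup_le_iff]
    exact fun a v hv => Submodule.subset_span ⟨a, Module.End.mem_eigenspace_iff.mp hv⟩
  let b₀ := Module.Basis.ofSpan hspan
  have hfin := Module.Finite.finite_basis b₀
  have := Fintype.ofFinite ((linearIndepOn_empty K id).extend
    (Set.empty_subset {v | ∃ a : K, T v = a • v}))
  let b := b₀.reindex (Fintype.equivFinOfCardEq (by
    rw [← Module.finrank_eq_card_basis b₀, Module.finrank_fin_fun] : _ = 3))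
  have hb : ∀ i, ∃ a : K, T (b i) = a • b i := fun i => by
    have : b i ∈ Set.range b₀ := by simp [b]
    exact Module.Basis.ofSpan_subset hspan this
  choose a ha using hb
  refine ⟨b, a, ha, fun i => ?_⟩
  have h : ∀ n : ℕ, (T ^ n) (b i) = a i ^ n • b i := fun n => by
    induction n with
    | zero => simp
    | succ n ih => rw [pow_succ', Module.End.mul_apply, ih, map_smul, ha, smul_smul, pow_succ]
  have h1 := h m
  rw [hT, LinearMap.smul_apply, Module.End.one_apply] at h1
  exact (smul_left_injective K (b.ne_zero i) h1).symm

lemma toMatrix_eq_diagonal {T : Module.End K (Fin 3 → K)}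
    {b : Module.Basis (Fin 3) K (Fin 3 → K)} {a : Fin 3 → K} (h : ∀ i, T (b i) = a i • b i) :
    LinearMap.toMatrix b b T = Matrix.diagonal a := by
  ext i j
  rw [LinearMap.toMatrix_apply, h, map_smul, Finsupp.smul_apply, b.repr_self,
    Finsupp.single_apply, Matrix.diagonal_apply]
  by_cases hij : j = i
  · subst hij; simp
  · simp [hij, Ne.symm hij]

lemma trace_eq_sum_of_basis_eigenvectors {T : Module.End K (Fin 3 → K)}
    {b : Module.Basis (Fin 3) K (Fin 3 → K)} {a : Fin 3 → K} (h : ∀ i, T (b i) = a i • b i) :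
    LinearMap.trace K _ T = a 0 + a 1 + a 2 := by
  rw [LinearMap.trace_eq_matrix_trace K b, toMatrix_eq_diagonal h, Matrix.trace_diagonal,
    Fin.sum_univ_three]

lemma det_eq_prod_of_basis_eigenvectors {T : Module.End K (Fin 3 → K)}
    {b : Module.Basis (Fin 3) K (Fin 3 → K)} {a : Fin 3 → K} (h : ∀ i, T (b i) = a i • b i) :
    LinearMap.det T = a 0 * a 1 * a 2 := by
  rw [← LinearMap.det_toMatrix b, toMatrix_eq_diagonal h, Matrix.det_diagonal,
    Fin.prod_univ_three]

/-- An automorphism of order `5` of a smooth sextic form cannot act on a plane as a nontrivial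
scalar and trivially on a complementary line. -/
lemma Preserves.eigenvalue_eq_one_of_eigenplane [IsAlgClosed K] [CharZero K]
    {T : Module.End K (Fin 3 → K)} {F : MvPolynomial (Fin 3) K} (hF : IsSmoothSextic F)
    (hT : Preserves T F) {b : Module.Basis (Fin 3) K (Fin 3 → K)} {a : K} (ha : a ^ 5 = 1)
    (h1 : T (b 1) = a • b 1) (h2 : T (b 2) = a • b 2) : a = 1 := by
  by_contra hne
  have ha0 : a ≠ 0 := by rintro rfl; simp at ha
  have hH : (∑ i, C (b 0 i) * pderiv i F).IsHomogeneous 5 :=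
    IsHomogeneous.sum _ _ _ fun i _ => by
      simpa using (isHomogeneous_C (Fin 3) (b 0 i)).mul (hF.1.pderiv (i := i))
  obtain ⟨s, t, hst, hz⟩ := exists_eval_smul_add_smul_eq_zero hH (by norm_num) (b 1) (b 2)
  have hw : T (s • b 1 + t • b 2) = a • (s • b 1 + t • b 2) := by
    rw [map_add, map_smul, map_smul, h1, h2, smul_add, smul_comm s a, smul_comm t a]
  set w := s • b 1 + t • b 2 with hwdef
  have hd : ∀ y, T y = a • y → differential F w y = 0 := fun y hy => by
    have := hT.differential_eigenvector hF.1 ha0 hw y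
    rw [hy, map_smul, ha, inv_one, one_mul, smul_eq_mul] at this
    have h3 : (a - 1) * differential F w y = 0 := by linear_combination this
    exact (mul_eq_zero.mp h3).resolve_left (sub_ne_zero.mpr hne)
  have hd0 : differential F w (b 0) = 0 := by
    rw [_root_.differential_apply, ← hz, map_sum]
    exact Finset.sum_congr rfl fun i _ => by simp [mul_comm]
  have hdw : differential F w = 0 := b.ext fun i => by
    fin_cases i
    · exact hd0
    · exact hd _ h1
    · exact hd _ h2
  have hw0 : w = 0 := eq_zero_of_differential_eq_zero hF fun y => by simp [hdw]
  have hs : s = 0 := by simpa [hwdef] using congrArg (fun v => b.repr v 1) hw0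
  have ht : t = 0 := by simpa [hwdef] using congrArg (fun v => b.repr v 2) hw0
  simp [hs, ht] at hst

/-- The possible eigenvalues of an automorphism of order `5` of a smooth sextic form. -/
lemma Preserves.eigenvalues_of_pow_five_eq_one [IsAlgClosed K] [CharZero K]
    {T : Module.End K (Fin 3 → K)} {F : MvPolynomial (Fin 3) K} (hF : IsSmoothSextic F)
    (hT : Preserves T F) (h5 : T ^ 5 = 1) :
    ∃ p q : K, p ^ 5 = 1 ∧ q ^ 5 = 1 ∧ (p = q → p = 1) ∧
      LinearMap.trace K _ T = 1 + p + q ∧ LinearMap.det T = p * q := by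
  obtain ⟨b, a, hb, ha⟩ := exists_basis_eigenvectors_of_pow_eq_smul_one (T := T) (m := 5)
    (by norm_num) one_ne_zero (by rw [h5, one_smul])
  have ha0 : a 0 ≠ 0 := fun h => by simpa [h] using ha 0
  have hev : T.HasEigenvalue 1 := by
    have := hT.hasEigenvalue_inv_pow hF ha0
      (Module.End.hasEigenvalue_of_hasEigenvector
        ⟨Module.End.mem_eigenspace_iff.mpr (hb 0), b.ne_zero 0⟩)
    rwa [ha, inv_one] at this
  obtain ⟨i, hi⟩ : ∃ i, a i = 1 := by
    obtain ⟨v, hv⟩ := hev.exists_hasEigenvector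
    by_contra! hne
    refine hv.2 (b.repr.map_eq_zero_iff.mp (Finsupp.ext fun i => ?_))
    have h1 : T v = v := by simpa using hv.apply_eq_smul
    have h2 : b.repr (T v) i = a i * b.repr v i := by
      have e : T v = ∑ j, b.repr v j • a j • b j := by
        conv_lhs => rw [← b.sum_repr v, map_sum]
        exact Finset.sum_congr rfl fun j _ => by rw [map_smul, hb]
      rw [e]
      simp [Finsupp.single_apply, mul_comm]
    rw [h1] at h2
    have h3 : (a i - 1) * b.repr v i = 0 := by linear_combination -h2
    exact (mul_eq_zero.mp h3).resolve_left (sub_ne_zero.mpr (hne i))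
  set e := Equiv.swap 0 i
  have hb' : ∀ j, T ((b.reindex e) j) = (a ∘ e) j • (b.reindex e) j := fun j => by
    simp [hb, e]
  have hae : a (e 0) = 1 := by simpa [e] using hi
  refine ⟨a (e 1), a (e 2), ha _, ha _, fun h => ?_, ?_, ?_⟩
  · exact hT.eigenvalue_eq_one_of_eigenplane hF (b := b.reindex e) (ha _) (hb' 1)
      (by rw [h]; exact hb' 2)
  · simp [trace_eq_sum_of_basis_eigenvectors hb', hae]
  · simp [det_eq_prod_of_basis_eigenvectors hb', hae]

lemma isPrimitiveRoot_sixty_one : IsPrimitiveRoot (61 : ZMod 1621) 180 := by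
  have h : (61 : ZMod 1621) ^ 180 = 1 ∧ ∀ l < 180, 0 < l → (61 : ZMod 1621) ^ l ≠ 1 := by
    decide +kernel
  exact (IsPrimitiveRoot.iff (by norm_num)).mpr ⟨h.1, fun l h0 hl => h.2 l hl h0⟩

/-- Integral relations between powers of a primitive `180`-th root of unity persist modulo the
prime `1621`, where `61` is a primitive `180`-th root of unity. -/
lemma eval_eq_zero_of_aeval_eq_zero [CharZero K] {η : K} (hη : IsPrimitiveRoot η 180)
    {P : Polynomial ℤ} (hP : Polynomial.aeval η P = 0) :
    Polynomial.aeval (61 : ZMod 1621) P = 0 := by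
  have : Fact (Nat.Prime 1621) := ⟨by norm_num⟩
  obtain ⟨Q, rfl⟩ : Polynomial.cyclotomic 180 ℤ ∣ P := by
    rw [Polynomial.cyclotomic_eq_minpoly hη (by norm_num)]
    exact minpoly.isIntegrallyClosed_dvd (hη.isIntegral (by norm_num)) hP
  have h := isPrimitiveRoot_sixty_one.isRoot_cyclotomic (by norm_num)
  rw [Polynomial.IsRoot, ← Polynomial.map_cyclotomic_int, Polynomial.eval_map] at h
  rw [map_mul, Polynomial.aeval_def, algebraMap_int_eq, h, zero_mul]

/-- The exponent data of the trace of an element of order `5` of determinant `1`, evaluated at a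
chosen `180`-th root of unity `r` of a ring. -/
def traceValue {R : Type*} [Semiring R] (r : R) (k e : ℕ) (b : Bool) : R :=
  r ^ (60 * e) * cond b (1 + r ^ (36 * k) + r ^ (72 * k)) (2 + r ^ (108 * k))

lemma finite_check : ∀ e₁ e₂ e₃ e₄ : Fin 3, ∀ b₁ b₂ b₃ b₄ : Bool,
    (traceValue 61 1 e₁ b₁ * 61 ^ 36 + traceValue 61 2 e₂ b₂ * 61 ^ 72 +
      traceValue 61 3 e₃ b₃ * 61 ^ 108 + traceValue 61 4 e₄ b₄ * 61 ^ 144) % 1621 =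
    (traceValue 61 1 e₁ b₁ * 61 ^ 72 + traceValue 61 2 e₂ b₂ * 61 ^ 144 +
      traceValue 61 3 e₃ b₃ * 61 ^ 216 + traceValue 61 4 e₄ b₄ * 61 ^ 288) % 1621 →
    ∀ m : Fin 6, ∀ y : Fin 15, ∀ z₁ z₂ : Fin 5, m ≠ 0 →
    (61 ^ (60 / m.val * y) * (1 + 61 ^ (180 / m.val * z₁) + 61 ^ (180 / m.val * z₂)) +
      (traceValue 61 1 e₁ b₁ * 61 ^ 36 + traceValue 61 2 e₂ b₂ * 61 ^ 72 +
      traceValue 61 3 e₃ b₃ * 61 ^ 108 + traceValue 61 4 e₄ b₄ * 61 ^ 144)) % 1621 = 0 →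
    180 ∣ 180 / m.val * z₁ ∧ 180 ∣ 180 / m.val * z₂ := by
  decide +kernel


lemma map_traceValue {R S : Type*} [Semiring R] [Semiring S] (f : R →+* S) (r : R) (k e : ℕ)
    (b : Bool) : f (traceValue r k e b) = traceValue (f r) k e b := by
  cases b <;> simp [traceValue, map_ofNat]

lemma aeval_traceValue {S : Type*} [CommRing S] (r : S) (k e : ℕ) (b : Bool) :
    Polynomial.aeval r (traceValue (Polynomial.X : Polynomial ℤ) k e b) = traceValue r k e b := by
  cases b <;> simp [traceValue, map_ofNat]

/-- The trace relations force the eigenvalues to coincide. -/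
lemma eigenvalues_eq_of_traces [IsAlgClosed K] [CharZero K] {ζ : K} (hζ : IsPrimitiveRoot ζ 5)
    {a₀ a₁ a₂ s : K} {m : ℕ} (hm : m ≠ 0) (hm5 : m ≤ 5) (hs : s ^ 3 = 1) {μ : Fin 3 → K}
    (hμ : ∀ i, μ i ^ m = s) (h0 : μ 0 + μ 1 + μ 2 = a₀ + a₁ + a₂)
    (h : ∀ k, 0 < k → k < 5 → ∃ c : K, c ^ 3 = 1 ∧
      (a₀ + a₁ * ζ ^ k + a₂ * ζ ^ (2 * k) = c * (1 + ζ ^ k + ζ ^ (2 * k)) ∨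
        a₀ + a₁ * ζ ^ k + a₂ * ζ ^ (2 * k) = c * (2 + ζ ^ (3 * k)))) :
    μ 1 = μ 0 ∧ μ 2 = μ 0 := by
  obtain ⟨η, hη, hηζ⟩ : ∃ η : K, IsPrimitiveRoot η 180 ∧ η ^ 36 = ζ := by
    obtain ⟨ξ, hξ⟩ := HasEnoughRootsOfUnity.exists_primitiveRoot K 36
    refine ⟨ξ * ζ, ?_, ?_⟩
    · have := (Commute.all ξ ζ).orderOf_mul_eq_mul_orderOf_of_coprime
        (by rw [← hξ.eq_orderOf, ← hζ.eq_orderOf]; norm_num)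
      rw [← hξ.eq_orderOf, ← hζ.eq_orderOf] at this
      have h2 := IsPrimitiveRoot.orderOf (ξ * ζ)
      rwa [this] at h2
    · rw [mul_pow, hξ.pow_eq_one, one_mul, show 36 = 5 * 7 + 1 from rfl, pow_succ, pow_mul,
        hζ.pow_eq_one, one_pow, one_mul]
  have ht : ∀ k, 0 < k → k < 5 → ∃ (e : Fin 3) (b : Bool),
      a₀ + a₁ * ζ ^ k + a₂ * ζ ^ (2 * k) = traceValue η k e b := by
    intro k hk hk5
    obtain ⟨c, hc, hck⟩ := h k hk hk5
    have h60 : IsPrimitiveRoot (η ^ 60) 3 := hη.pow (by norm_num) (by norm_num)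
    obtain ⟨e, he, rfl⟩ := h60.eq_pow_of_pow_eq_one hc
    have e72 : η ^ (72 * k) = ζ ^ (2 * k) := by rw [← hηζ, ← pow_mul]; congr 1; ring
    have e36 : η ^ (36 * k) = ζ ^ k := by rw [← hηζ, ← pow_mul]
    have e108 : η ^ (108 * k) = ζ ^ (3 * k) := by rw [← hηζ, ← pow_mul]; congr 1; ring
    rcases hck with hck | hck
    · exact ⟨⟨e, he⟩, true, by rw [hck, traceValue, cond_true, e36, e72, pow_mul η]⟩
    · exact ⟨⟨e, he⟩, false, by rw [hck, traceValue, cond_false, e108, pow_mul η]⟩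
  obtain ⟨e₁, b₁, h1⟩ := ht 1 (by norm_num) (by norm_num)
  obtain ⟨e₂, b₂, h2⟩ := ht 2 (by norm_num) (by norm_num)
  obtain ⟨e₃, b₃, h3⟩ := ht 3 (by norm_num) (by norm_num)
  obtain ⟨e₄, b₄, h4⟩ := ht 4 (by norm_num) (by norm_num)
  have hdvd : m ∣ 60 := by interval_cases m <;> first | contradiction | decide
  obtain ⟨n, hn⟩ := hdvd
  have hm0 : 0 < m := Nat.pos_of_ne_zero hm
  have hdiv : 60 / m = n := by rw [hn, Nat.mul_div_cancel_left _ hm0]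
  have hdiv3 : 180 / m = 3 * n := by
    rw [show 180 = m * (3 * n) by linarith, Nat.mul_div_cancel_left _ hm0]
  have : NeZero m := ⟨hm⟩
  obtain ⟨y, hy, hμ0⟩ : ∃ y < m * 3, (η ^ n) ^ y = μ 0 :=
    (hη.pow (by norm_num) (by linarith)).eq_pow_of_pow_eq_one (by rw [pow_mul, hμ, hs])
      (k := m * 3)
  have hs0 : s ≠ 0 := by rintro rfl; simp at hs
  have hμ00 : μ 0 ≠ 0 := fun e => hs0 (by rw [← hμ 0, e, zero_pow hm])
  have hμi : ∀ i, ∃ z < m, μ i = μ 0 * η ^ (3 * n * z) := fun i => by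
    obtain ⟨z, hz, e⟩ := (hη.pow (by norm_num) (by linarith) :
      IsPrimitiveRoot (η ^ (3 * n)) m).eq_pow_of_pow_eq_one
      (ξ := μ i / μ 0) (by rw [div_pow, hμ, hμ, div_self hs0])
    exact ⟨z, hz, by rw [pow_mul, e, mul_div_cancel₀ _ hμ00]⟩
  obtain ⟨z₁, hz₁, hμ1⟩ := hμi 1
  obtain ⟨z₂, hz₂, hμ2⟩ := hμi 2
  have hsum : 1 + ζ + ζ ^ 2 + ζ ^ 3 + ζ ^ 4 = 0 := by
    have := hζ.geom_sum_eq_zero (by norm_num)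
    simpa [Finset.sum_range_succ] using this
  have h5 : ζ ^ 5 = 1 := hζ.pow_eq_one
  have hE1 : traceValue η 1 e₁ b₁ * η ^ 36 + traceValue η 2 e₂ b₂ * η ^ 72 +
      traceValue η 3 e₃ b₃ * η ^ 108 + traceValue η 4 e₄ b₄ * η ^ 144 = -(a₀ + a₁ + a₂) := by
    rw [← h1, ← h2, ← h3, ← h4, show η ^ 72 = (η ^ 36) ^ 2 by ring,
      show η ^ 108 = (η ^ 36) ^ 3 by ring, show η ^ 144 = (η ^ 36) ^ 4 by ring, hηζ]
    linear_combination (a₀ + a₁ + a₂) * hsum + (a₁ * (ζ + ζ ^ 3) +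
      a₂ * (ζ + ζ ^ 4 + ζ ^ 7 + ζ ^ 2)) * h5
  have hE2 : traceValue η 1 e₁ b₁ * η ^ 72 + traceValue η 2 e₂ b₂ * η ^ 144 +
      traceValue η 3 e₃ b₃ * η ^ 216 + traceValue η 4 e₄ b₄ * η ^ 288 = -(a₀ + a₁ + a₂) := by
    rw [← h1, ← h2, ← h3, ← h4, show η ^ 72 = (η ^ 36) ^ 2 by ring,
      show η ^ 144 = (η ^ 36) ^ 4 by ring, show η ^ 216 = (η ^ 36) ^ 6 by ring,
      show η ^ 288 = (η ^ 36) ^ 8 by ring, hηζ]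
    linear_combination (a₀ + a₁ + a₂) * hsum + (a₀ * (ζ + ζ ^ 3) + a₁ * (ζ + ζ ^ 4 + ζ ^ 7 + ζ ^ 2) +
      a₂ * (ζ ^ 3 + ζ ^ 7 + ζ ^ 2 + ζ ^ 11 + ζ ^ 6 + ζ)) * h5
  have hfin := finite_check e₁ e₂ e₃ e₄ b₁ b₂ b₃ b₄ ?_ ⟨m, by omega⟩ ⟨y, by omega⟩
    ⟨z₁, by omega⟩ ⟨z₂, by omega⟩ (by simpa [Fin.ext_iff] using hm) ?_
  · simp only [hdiv3, ← hη.pow_eq_one_iff_dvd] at hfin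
    rw [hμ1, hμ2, hfin.1, hfin.2, mul_one]
    exact ⟨rfl, rfl⟩
  · change Nat.ModEq 1621 _ _
    rw [← ZMod.natCast_eq_natCast_iff]
    have := eval_eq_zero_of_aeval_eq_zero hη
      (P := traceValue .X 1 e₁ b₁ * .X ^ 36 + traceValue .X 2 e₂ b₂ * .X ^ 72 +
        traceValue .X 3 e₃ b₃ * .X ^ 108 + traceValue .X 4 e₄ b₄ * .X ^ 144 -
        (traceValue .X 1 e₁ b₁ * .X ^ 72 + traceValue .X 2 e₂ b₂ * .X ^ 144 +
        traceValue .X 3 e₃ b₃ * .X ^ 216 + traceValue .X 4 e₄ b₄ * .X ^ 288))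
      (by
        simp only [map_sub, map_add, map_mul, map_pow, aeval_traceValue, Polynomial.aeval_X]
        rw [hE1, hE2, sub_self])
    simp only [map_sub, map_add, map_mul, map_pow, aeval_traceValue, Polynomial.aeval_X,
      sub_eq_zero] at this
    have hc := fun k e b => map_traceValue (Nat.castRingHom (ZMod 1621)) 61 k e b
    simp only [Nat.coe_castRingHom, Nat.cast_ofNat] at hc
    simpa only [Nat.cast_add, Nat.cast_mul, Nat.cast_pow, hc, Nat.cast_ofNat] using this
  · rw [← Nat.dvd_iff_mod_eq_zero, ← ZMod.natCast_eq_zero_iff]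
    simp only [hdiv, hdiv3]
    have := eval_eq_zero_of_aeval_eq_zero hη
      (P := .X ^ (n * y) * (1 + .X ^ (3 * n * z₁) + .X ^ (3 * n * z₂)) +
        (traceValue .X 1 e₁ b₁ * .X ^ 36 + traceValue .X 2 e₂ b₂ * .X ^ 72 +
        traceValue .X 3 e₃ b₃ * .X ^ 108 + traceValue .X 4 e₄ b₄ * .X ^ 144))
      (by
        simp only [map_add, map_mul, map_pow, map_one, aeval_traceValue, Polynomial.aeval_X]
        rw [hE1, ← h0, hμ1, hμ2, ← hμ0]
        ring)
    simp only [map_add, map_mul, map_pow, map_one, aeval_traceValue, Polynomial.aeval_X] at this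
    have hc := fun k e b => map_traceValue (Nat.castRingHom (ZMod 1621)) 61 k e b
    simp only [Nat.coe_castRingHom, Nat.cast_ofNat] at hc
    simpa only [Nat.cast_add, Nat.cast_mul, Nat.cast_pow, Nat.cast_one, hc, Nat.cast_ofNat]
      using this

lemma eval_matAct (A : Matrix (Fin 3) (Fin 3) K) (F : MvPolynomial (Fin 3) K) (x : Fin 3 → K) :
    eval x (matAct A F) = eval (A.toLin' x) F := by
  unfold matAct
  induction F using MvPolynomial.induction_on with
  | C a => simp
  | add p q hp hq => rw [map_add, map_add, map_add, hp, hq]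
  | mul_X p i hp =>
    rw [map_mul, map_mul, hp, aeval_X, map_mul, eval_X]
    simp [Matrix.mulVec, dotProduct]

lemma preserves_toLin'_iff [Infinite K] {A : Matrix (Fin 3) (Fin 3) K}
    {F : MvPolynomial (Fin 3) K} : Preserves A.toLin' F ↔ matAct A F = F :=
  ⟨fun h => MvPolynomial.funext fun x => (eval_matAct A F x).trans (h x),
    fun h x => by rw [← eval_matAct, h]⟩

lemma Preserves.toLin'_mul {A B : Matrix (Fin 3) (Fin 3) K} {F : MvPolynomial (Fin 3) K}
    (hA : Preserves A.toLin' F) (hB : Preserves B.toLin' F) : Preserves (A * B).toLin' F := by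
  rw [Matrix.toLin'_mul]
  exact hA.mul hB

lemma mk_eq_one_iff_exists_smul (A : GL3 K) :
    (QuotientGroup.mk A : PGL3 K) = 1 ↔ ∃ t : K, (A : Matrix (Fin 3) (Fin 3) K) = t • 1 := by
  rw [QuotientGroup.eq_one_iff, Matrix.GeneralLinearGroup.mem_center_iff_val_mem_range_scalar]
  simp [Matrix.smul_one_eq_diagonal, eq_comm]

lemma Preserves.mk_mem_planeAut [Infinite K] {A : GL3 K} {F : MvPolynomial (Fin 3) K}
    (hA : Preserves (A : Matrix (Fin 3) (Fin 3) K).toLin' F) :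
    (QuotientGroup.mk A : PGL3 K) ∈ planeAut F :=
  ⟨A, rfl, 1, one_ne_zero, by rw [preserves_toLin'_iff.mp hA, one_smul]⟩

lemma IsSmoothSextic.ne_zero {F : MvPolynomial (Fin 3) K} (hF : IsSmoothSextic F) : F ≠ 0 := by
  rintro rfl
  simpa using congrFun (hF.2 (fun _ => 1) (by simp) (by simp)) 0

lemma Preserves.exists_pow_eq_smul_one [IsAlgClosed K] [CharZero K]
    {F : MvPolynomial (Fin 3) K} (hF : IsSmoothSextic F) (hord : ∀ g ∈ planeAut F, orderOf g ≤ 5)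
    {A : Matrix (Fin 3) (Fin 3) K} (hu : IsUnit A) (hA : Preserves A.toLin' F) :
    ∃ m : ℕ, m ≠ 0 ∧ m ≤ 5 ∧ ∃ s : K, s ^ 6 = 1 ∧ A ^ m = s • 1 := by
  obtain ⟨u, rfl⟩ := hu
  have hpow : ∀ n : ℕ, ((u : Matrix (Fin 3) (Fin 3) K) ^ n).toLin' =
      (u : Matrix (Fin 3) (Fin 3) K).toLin' ^ n := Matrix.toLin'_pow _
  obtain ⟨n, hn, hun⟩ := hA.exists_pow_eq_one hF (u.isUnit.map Matrix.toLinAlgEquiv')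
  have hun' : u ^ n = 1 := by
    ext1
    apply Matrix.toLin'.injective
    rw [Units.val_pow_eq_pow_val, hpow, hun, Units.val_one, Matrix.toLin'_one]
    rfl
  set g : PGL3 K := QuotientGroup.mk u with hg
  have hgn : g ^ n = 1 := by rw [hg, ← QuotientGroup.mk_pow, hun', QuotientGroup.mk_one]
  refine ⟨orderOf g, (orderOf_pos_iff.mpr (isOfFinOrder_iff_pow_eq_one.mpr ⟨n, hn, hgn⟩)).ne',
    hord g hA.mk_mem_planeAut, ?_⟩
  have h1 : (QuotientGroup.mk (u ^ orderOf g) : PGL3 K) = 1 := by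
    rw [QuotientGroup.mk_pow, ← hg, pow_orderOf_eq_one]
  obtain ⟨s, hs⟩ := (mk_eq_one_iff_exists_smul _).mp h1
  rw [Units.val_pow_eq_pow_val] at hs
  refine ⟨s, ?_, hs⟩
  obtain ⟨x, hx⟩ : ∃ x, eval x F ≠ 0 := by
    by_contra! h
    exact hF.ne_zero (MvPolynomial.funext fun x => by rw [h, map_zero])
  have h2 := hA.pow (orderOf g) x
  rw [← hpow, hs, map_smul, Matrix.toLin'_one, LinearMap.smul_apply, LinearMap.id_apply,
    eval_smul_of_isHomogeneous hF.1] at h2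
  exact mul_right_cancel₀ hx (h2.trans (one_mul _).symm)

/-- An automorphism whose determinant is not a `24`-th root of unity has order `5`, which
restricts its trace and its determinant. -/
lemma Preserves.trace_det [IsAlgClosed K] [CharZero K]
    {F : MvPolynomial (Fin 3) K} (hF : IsSmoothSextic F) (hord : ∀ g ∈ planeAut F, orderOf g ≤ 5)
    {A : Matrix (Fin 3) (Fin 3) K} (hu : IsUnit A) (hA : Preserves A.toLin' F)
    (hdet : A.det ^ 24 ≠ 1) :
    ∃ c p q : K, c ^ 6 = 1 ∧ p ^ 5 = 1 ∧ q ^ 5 = 1 ∧ (p = q → p = 1) ∧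
      A.trace = c * (1 + p + q) ∧ A.det = c ^ 3 * (p * q) := by
  obtain ⟨m, hm, hm5, s, hs, hAm⟩ := hA.exists_pow_eq_smul_one hF hord hu
  have hd : A.det ^ m = s ^ 3 := by
    rw [← Matrix.det_pow, hAm, Matrix.det_smul, Matrix.det_one, mul_one, Fintype.card_fin]
  have hd2 : A.det ^ (2 * m) = 1 := by
    rw [mul_comm, pow_mul, hd, ← pow_mul, hs]
  obtain rfl | hlt := hm5.eq_or_lt
  · have hs0 : s ≠ 0 := by rintro rfl; simp at hs
    have h5 : (s • A.toLin') ^ 5 = 1 := by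
      rw [smul_pow, ← Matrix.toLin'_pow, hAm, map_smul, smul_smul, ← pow_succ, hs, one_smul,
        Matrix.toLin'_one]
      rfl
    obtain ⟨p, q, hp, hq, hpq, htr, hdt⟩ := (hA.smul hF.1 hs).eigenvalues_of_pow_five_eq_one hF h5
    refine ⟨s⁻¹, p, q, by rw [inv_pow, hs, inv_one], hp, hq, hpq, ?_, ?_⟩
    · rw [← htr, map_smul, Matrix.trace_toLin'_eq, smul_eq_mul, inv_mul_cancel_left₀ hs0]
    · rw [← hdt, LinearMap.det_smul, LinearMap.det_toLin', Module.finrank_fin_fun, inv_pow,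
        inv_mul_cancel_left₀ (pow_ne_zero 3 hs0)]
  · refine absurd ?_ hdet
    obtain ⟨j, hj⟩ : 2 * m ∣ 24 := by interval_cases m <;> first | contradiction | decide
    rw [hj, pow_mul, hd2, one_pow]

lemma IsPrimitiveRoot.pow_of_lt_five {ζ : K} (hζ : IsPrimitiveRoot ζ 5) {k : ℕ} (hk : 0 < k)
    (hk5 : k < 5) : IsPrimitiveRoot (ζ ^ k) 5 :=
  hζ.pow_of_coprime k (by interval_cases k <;> decide)

/-- The eigenvalues `1, p, q` of an element of order `5` with `p * q = u ^ 3`. -/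
lemma one_add_add_eq_of_mul_eq_cube {u p q : K} (hu : IsPrimitiveRoot u 5) (hp : p ^ 5 = 1)
    (hq : q ^ 5 = 1) (hpq : p = q → p = 1) (h : p * q = u ^ 3) :
    1 + p + q = 1 + u + u ^ 2 ∨ 1 + p + q = 2 + u ^ 3 := by
  obtain ⟨i, hi, rfl⟩ := hu.eq_pow_of_pow_eq_one hp
  obtain ⟨j, hj, rfl⟩ := hu.eq_pow_of_pow_eq_one hq
  have h5 : u ^ 5 = 1 := hu.pow_eq_one
  have hmod : (i + j) % 5 = 3 := by
    refine hu.pow_inj (Nat.mod_lt _ (by norm_num)) (by norm_num) ?_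
    rw [← h, ← pow_add]
    conv_rhs => rw [← Nat.div_add_mod (i + j) 5, pow_add, pow_mul, h5, one_pow, one_mul]
  have h4 : ¬(i = 4 ∧ j = 4) := by
    rintro ⟨rfl, rfl⟩
    exact hu.pow_ne_one_of_pos_of_lt (by norm_num) (by norm_num) (hpq rfl)
  interval_cases i <;> interval_cases j <;> simp at hmod h4
  · right; ring
  · left; ring
  · left; ring
  · right; ring

section Scalar

variable [IsAlgClosed K] [CharZero K] {F : MvPolynomial (Fin 3) K} {ζ : K}
  {A : Matrix (Fin 3) (Fin 3) K}

lemma Preserves.trace_det_mul_diagonal (hF : IsSmoothSextic F)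
    (hord : ∀ g ∈ planeAut F, orderOf g ≤ 5) (hζ : IsPrimitiveRoot ζ 5)
    (hσ : ∀ u : K, u ^ 5 = 1 → Preserves (Matrix.diagonal ![1, u, u ^ 2]).toLin' F)
    (hA : Preserves A.toLin' F) (hdet : A.det ^ 24 = 1) {k : ℕ} (hk : 0 < k) (hk5 : k < 5) :
    ∃ c p q : K, c ^ 6 = 1 ∧ p ^ 5 = 1 ∧ q ^ 5 = 1 ∧ (p = q → p = 1) ∧
      A 0 0 + A 1 1 * ζ ^ k + A 2 2 * ζ ^ (2 * k) = c * (1 + p + q) ∧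
      A.det * (ζ ^ k) ^ 3 = c ^ 3 * (p * q) := by
  have hu := hζ.pow_of_lt_five hk hk5
  have hu0 : ζ ^ k ≠ 0 := hu.ne_zero (by norm_num)
  have hd : (A * Matrix.diagonal ![1, ζ ^ k, (ζ ^ k) ^ 2]).det = A.det * (ζ ^ k) ^ 3 := by
    rw [Matrix.det_mul, Matrix.det_diagonal, Fin.prod_univ_three]
    simp only [Matrix.cons_val]
    ring
  have hA0 : A.det ≠ 0 := fun e => by simp [e] at hdet
  have ht : (A * Matrix.diagonal ![1, ζ ^ k, (ζ ^ k) ^ 2]).trace =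
      A 0 0 + A 1 1 * ζ ^ k + A 2 2 * ζ ^ (2 * k) := by
    simp only [Matrix.trace_fin_three, Matrix.mul_diagonal, Matrix.cons_val]
    ring
  rw [← hd, ← ht]
  refine (hA.toLin'_mul (hσ _ hu.pow_eq_one)).trace_det hF hord ?_ ?_
  · rw [Matrix.isUnit_iff_isUnit_det, hd]
    exact (mul_ne_zero hA0 (pow_ne_zero 3 hu0)).isUnit
  · rw [hd, mul_pow, hdet, one_mul, ← pow_mul]
    intro e
    have := hu.dvd_of_pow_eq_one _ e
    norm_num at this

lemma Preserves.det_sq_eq_one (hF : IsSmoothSextic F)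
    (hord : ∀ g ∈ planeAut F, orderOf g ≤ 5) (hζ : IsPrimitiveRoot ζ 5)
    (hσ : ∀ u : K, u ^ 5 = 1 → Preserves (Matrix.diagonal ![1, u, u ^ 2]).toLin' F)
    (hA : Preserves A.toLin' F) (hdet : A.det ^ 24 = 1) : A.det ^ 2 = 1 := by
  obtain ⟨c, p, q, hc, hp, hq, -, -, hd⟩ :=
    hA.trace_det_mul_diagonal hF hord hζ hσ hdet (k := 1) (by norm_num) (by norm_num)
  have h10 : A.det ^ 10 = 1 := by
    have e : (A.det * (ζ ^ 1) ^ 3) ^ 10 = (c ^ 3 * (p * q)) ^ 10 := by rw [hd]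
    calc A.det ^ 10 = A.det ^ 10 * (ζ ^ 5) ^ 6 := by rw [hζ.pow_eq_one, one_pow, mul_one]
      _ = (A.det * (ζ ^ 1) ^ 3) ^ 10 := by ring
      _ = (c ^ 6) ^ 5 * (p ^ 5) ^ 2 * (q ^ 5) ^ 2 := by rw [e]; ring
      _ = 1 := by rw [hc, hp, hq]; norm_num
  have h4 : A.det ^ 4 = 1 := by
    rw [← hdet, show A.det ^ 24 = (A.det ^ 10) ^ 2 * A.det ^ 4 by ring, h10, one_pow, one_mul]
  rw [← h10, show A.det ^ 10 = (A.det ^ 4) ^ 2 * A.det ^ 2 by ring, h4, one_pow, one_mul]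

lemma Preserves.eq_smul_one_of_det_eq_one (hF : IsSmoothSextic F)
    (hord : ∀ g ∈ planeAut F, orderOf g ≤ 5) (hζ : IsPrimitiveRoot ζ 5)
    (hσ : ∀ u : K, u ^ 5 = 1 → Preserves (Matrix.diagonal ![1, u, u ^ 2]).toLin' F)
    (hA : Preserves A.toLin' F) (hdet : A.det = 1) : ∃ t : K, A = t • 1 := by
  have hu : IsUnit A := by rw [Matrix.isUnit_iff_isUnit_det, hdet]; exact isUnit_one
  obtain ⟨m, hm, hm5, s, hs, hAm⟩ := hA.exists_pow_eq_smul_one hF hord hu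
  have hs3 : s ^ 3 = 1 := by
    have := congrArg Matrix.det hAm
    rw [Matrix.det_pow, hdet, one_pow, Matrix.det_smul, Matrix.det_one, mul_one,
      Fintype.card_fin] at this
    exact this.symm
  have hs0 : s ≠ 0 := by rintro rfl; simp at hs
  obtain ⟨b, μ, hb, hμ⟩ := exists_basis_eigenvectors_of_pow_eq_smul_one (T := A.toLin') hm hs0
    (by rw [← Matrix.toLin'_pow, hAm, map_smul, Matrix.toLin'_one]; rfl)
  have htr := trace_eq_sum_of_basis_eigenvectors hb
  rw [Matrix.trace_toLin'_eq, Matrix.trace_fin_three] at htr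
  obtain ⟨h1, h2⟩ := eigenvalues_eq_of_traces hζ hm hm5 hs3 hμ htr.symm fun k hk hk5 => by
    obtain ⟨c, p, q, hc, hp, hq, hpq, ht, hd⟩ :=
      hA.trace_det_mul_diagonal hF hord hζ hσ (by rw [hdet, one_pow]) hk hk5
    have hk' := hζ.pow_of_lt_five hk hk5
    rw [hdet, one_mul] at hd
    have hc3 : c ^ 3 = 1 := by
      calc c ^ 3 = (c ^ 6)⁻¹ * (c ^ 6)⁻¹ * (c ^ 3) ^ 5 * p ^ 5 * q ^ 5 := by
            rw [hp, hq, show (c ^ 3) ^ 5 = c ^ 6 * c ^ 6 * c ^ 3 by ring, hc]; simp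
        _ = (c ^ 3 * (p * q)) ^ 5 := by rw [hc]; ring
        _ = ((ζ ^ k) ^ 5) ^ 3 := by rw [← hd]; ring
        _ = 1 := by rw [hk'.pow_eq_one, one_pow]
    rw [hc3, one_mul] at hd
    refine ⟨c, hc3, ?_⟩
    rw [ht, mul_comm 2 k, mul_comm 3 k, pow_mul, pow_mul]
    exact (one_add_add_eq_of_mul_eq_cube hk' hp hq hpq hd.symm).imp
      (fun e => by rw [e]) fun e => by rw [e]
  refine ⟨μ 0, Matrix.toLin'.injective (b.ext fun i => ?_)⟩
  rw [hb, map_smul, Matrix.toLin'_one, LinearMap.smul_apply, LinearMap.id_apply]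
  fin_cases i
  · rfl
  · exact congrArg (· • b 1) h1
  · exact congrArg (· • b 2) h2

lemma Preserves.exists_mul_diagonal_pow_eq_smul_one (hF : IsSmoothSextic F)
    (hord : ∀ g ∈ planeAut F, orderOf g ≤ 5) (hζ : IsPrimitiveRoot ζ 5)
    (hσ : ∀ u : K, u ^ 5 = 1 → Preserves (Matrix.diagonal ![1, u, u ^ 2]).toLin' F)
    (hA : Preserves A.toLin' F) (hu : IsUnit A) :
    ∃ (i : ℕ) (t : K), A * Matrix.diagonal ![1, ζ, ζ ^ 2] ^ i = t • 1 := by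
  have hpres : ∀ i : ℕ, Preserves (A * Matrix.diagonal ![1, ζ, ζ ^ 2] ^ i).toLin' F := fun i =>
    hA.toLin'_mul (by rw [Matrix.toLin'_pow]; exact (hσ ζ hζ.pow_eq_one).pow i)
  have hdet : ∀ i : ℕ, (A * Matrix.diagonal ![1, ζ, ζ ^ 2] ^ i).det = A.det * (ζ ^ 3) ^ i := by
    intro i
    rw [Matrix.det_mul, Matrix.det_pow, Matrix.det_diagonal, Fin.prod_univ_three]
    simp only [Matrix.cons_val]
    ring
  obtain ⟨i, hi⟩ : ∃ i : ℕ, (A * Matrix.diagonal ![1, ζ, ζ ^ 2] ^ i).det ^ 24 = 1 := by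
    by_cases h24 : A.det ^ 24 = 1
    · exact ⟨0, by rw [hdet, pow_zero, mul_one, h24]⟩
    · obtain ⟨c, p, q, hc, hp, hq, -, -, hd⟩ := hA.trace_det hF hord hu h24
      obtain ⟨j, -, hj⟩ := hζ.eq_pow_of_pow_eq_one (ξ := p * q) (by rw [mul_pow, hp, hq, one_mul])
      refine ⟨3 * j, ?_⟩
      rw [hdet, hd, ← hj]
      calc (c ^ 3 * ζ ^ j * (ζ ^ 3) ^ (3 * j)) ^ 24 = (c ^ 6) ^ 12 * (ζ ^ 5) ^ (48 * j) := by ring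
        _ = 1 := by rw [hc, hζ.pow_eq_one, one_pow, one_pow, one_mul]
  set B := A * Matrix.diagonal ![1, ζ, ζ ^ 2] ^ i with hB
  have hB2 : B.det ^ 2 = 1 := (hpres i).det_sq_eq_one hF hord hζ hσ hi
  have hδ0 : B.det ≠ 0 := fun e => by simp [e] at hB2
  obtain ⟨t, ht⟩ := Preserves.eq_smul_one_of_det_eq_one (A := B.det • B) hF hord hζ hσ
    (by
      rw [map_smul]
      exact (hpres i).smul hF.1 (by rw [show 6 = 2 * 3 from rfl, pow_mul, hB2, one_pow]))
    (by
      rw [Matrix.det_smul, Fintype.card_fin, ← pow_succ, show 3 + 1 = 2 * 2 from rfl, pow_mul,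
        hB2, one_pow])
  exact ⟨i, B.det⁻¹ * t, by rw [mul_smul, ← ht, inv_smul_smul₀ hδ0]⟩

end Scalar

/-- A smooth sextic form invariant under `diag(1, ζ, ζ²)`, all of whose automorphisms have order at
most `5`, has the group generated by `diag(1, ζ, ζ²)` as its automorphism group. -/
lemma planeAut_eq_zpowers_of_preserves_diagonal [IsAlgClosed K] [CharZero K]
    {F : MvPolynomial (Fin 3) K} {ζ : K} (hF : IsSmoothSextic F)
    (hord : ∀ g ∈ planeAut F, orderOf g ≤ 5) (hζ : IsPrimitiveRoot ζ 5)
    (hσ : ∀ u : K, u ^ 5 = 1 → Preserves (Matrix.diagonal ![1, u, u ^ 2]).toLin' F) :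
    planeAut F = Subgroup.zpowers (pgl (Matrix.diagonal ![1, ζ, ζ ^ 2])) ∧
      Nat.card ↥(planeAut F) = 5 := by
  have hu : IsUnit (Matrix.diagonal ![1, ζ, ζ ^ 2]) := by
    have hζ0 : ζ ≠ 0 := hζ.ne_zero (by norm_num)
    rw [Matrix.isUnit_iff_isUnit_det, Matrix.det_diagonal, Fin.prod_univ_three]
    simp [hζ0]
  have hpgl : pgl (Matrix.diagonal ![1, ζ, ζ ^ 2]) = QuotientGroup.mk hu.unit := by
    unfold pgl
    rw [dif_pos hu]
  have hle : planeAut F = Subgroup.zpowers (pgl (Matrix.diagonal ![1, ζ, ζ ^ 2])) := by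
    rw [hpgl]
    refine le_antisymm ?_ ?_
    · rintro g ⟨A, rfl, c, hc, hA⟩
      obtain ⟨r, hr⟩ := IsAlgClosed.exists_pow_nat_eq c⁻¹ (n := 6) (by norm_num)
      have hr0 : r ≠ 0 := by rintro rfl; simp [eq_comm, hc] at hr
      have hpres : Preserves (r • (A : Matrix (Fin 3) (Fin 3) K)).toLin' F := fun x => by
        rw [map_smul, LinearMap.smul_apply, eval_smul_of_isHomogeneous hF.1, ← eval_matAct, hA,
          smul_eval, hr, inv_mul_cancel_left₀ hc]
      have hru : IsUnit (r • (A : Matrix (Fin 3) (Fin 3) K)) :=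
        (Units.mk0 r hr0 • A).isUnit
      obtain ⟨i, t, ht⟩ :=
        hpres.exists_mul_diagonal_pow_eq_smul_one hF hord hζ hσ hru
      have h1 : (QuotientGroup.mk (A * hu.unit ^ i) : PGL3 K) = 1 := by
        refine (mk_eq_one_iff_exists_smul _).mpr ⟨r⁻¹ * t, ?_⟩
        rw [Units.val_mul, Units.val_pow_eq_pow_val, IsUnit.unit_spec, mul_smul, ← ht,
          smul_mul_assoc, inv_smul_smul₀ hr0]
      rw [QuotientGroup.mk_mul, QuotientGroup.mk_pow] at h1
      rw [eq_inv_of_mul_eq_one_left h1]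
      exact inv_mem (pow_mem (Subgroup.mem_zpowers _) i)
    · rw [Subgroup.zpowers_le]
      exact Preserves.mk_mem_planeAut (hσ ζ hζ.pow_eq_one)
  refine ⟨hle, ?_⟩
  rw [hle, Nat.card_zpowers, hpgl]
  have : Fact (Nat.Prime 5) := ⟨by norm_num⟩
  refine orderOf_eq_prime ?_ fun e => ?_
  · rw [← QuotientGroup.mk_pow, mk_eq_one_iff_exists_smul]
    refine ⟨1, ?_⟩
    rw [Units.val_pow_eq_pow_val, IsUnit.unit_spec, Matrix.diagonal_pow, one_smul,
      ← Matrix.diagonal_one]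
    congr 1
    funext i
    have h5 := hζ.pow_eq_one
    fin_cases i
    · simp
    · simpa using h5
    · have h10 : ζ ^ 10 = 1 := by rw [show 10 = 5 * 2 from rfl, pow_mul, h5, one_pow]
      simpa [← pow_mul] using h10
  · obtain ⟨t, ht⟩ := (mk_eq_one_iff_exists_smul _).mp e
    rw [IsUnit.unit_spec] at ht
    have h0 := congrFun (congrFun ht 0) 0
    have h1 := congrFun (congrFun ht 1) 1
    simp at h0 h1
    exact hζ.ne_one (by norm_num) (h1.trans h0.symm)

lemma preserves_diagonal_sextic (β31 β23 β02 : K) {u : K} (hu : u ^ 5 = 1) :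
    Preserves (Matrix.diagonal ![1, u, u ^ 2]).toLin'
      (X 0 ^ 6 + X 0 * X 1 ^ 5 + X 0 * X 2 ^ 5
      + C β31 * X 0 ^ 3 * X 1 * X 2 ^ 2 + C β23 * X 0 ^ 2 * X 1 ^ 3 * X 2
      + C β02 * X 1 ^ 2 * X 2 ^ 4 : MvPolynomial (Fin 3) K) := fun x => by
  simp only [map_add, map_mul, map_pow, eval_X, eval_C, Matrix.toLin'_apply,
    Matrix.mulVec_diagonal, Matrix.cons_val]
  linear_combination (x 0 * x 1 ^ 5 + x 0 * x 2 ^ 5 * (u ^ 5 + 1) +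
    β31 * x 0 ^ 3 * x 1 * x 2 ^ 2 + β23 * x 0 ^ 2 * x 1 ^ 3 * x 2 +
    β02 * x 1 ^ 2 * x 2 ^ 4 * (u ^ 5 + 1)) * hu

/-- For `β₃₁, β₂₃, β₀₂ ∈ K` with
`X⁶ + XY⁵ + XZ⁵ + β₃₁X³YZ² + β₂₃X²Y³Z + β₀₂Y²Z⁴` smooth and all automorphisms of order at
most `5`, the automorphism group is cyclic of order `5`, generated by `σ = diag(1, ζ₅, ζ₅²)`. -/
theorem typeFiveTwo_sextic_automorphisms {K : Type*} [Field K] [IsAlgClosed K] [CharZero K]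
    (ζ : K) (hζ : IsPrimitiveRoot ζ 5) (β31 β23 β02 : K)
    (hsm : IsSmoothSextic (X 0 ^ 6 + X 0 * X 1 ^ 5 + X 0 * X 2 ^ 5
      + C β31 * X 0 ^ 3 * X 1 * X 2 ^ 2 + C β23 * X 0 ^ 2 * X 1 ^ 3 * X 2
      + C β02 * X 1 ^ 2 * X 2 ^ 4 : MvPolynomial (Fin 3) K))
    (hord : ∀ g ∈ planeAut (X 0 ^ 6 + X 0 * X 1 ^ 5 + X 0 * X 2 ^ 5
      + C β31 * X 0 ^ 3 * X 1 * X 2 ^ 2 + C β23 * X 0 ^ 2 * X 1 ^ 3 * X 2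
      + C β02 * X 1 ^ 2 * X 2 ^ 4 : MvPolynomial (Fin 3) K), orderOf g ≤ 5) :
    planeAut (X 0 ^ 6 + X 0 * X 1 ^ 5 + X 0 * X 2 ^ 5
        + C β31 * X 0 ^ 3 * X 1 * X 2 ^ 2 + C β23 * X 0 ^ 2 * X 1 ^ 3 * X 2
        + C β02 * X 1 ^ 2 * X 2 ^ 4 : MvPolynomial (Fin 3) K)
      = Subgroup.zpowers (pgl !![1, 0, 0; 0, ζ, 0; 0, 0, ζ ^ 2]) ∧
    Nat.card ↥(planeAut (X 0 ^ 6 + X 0 * X 1 ^ 5 + X 0 * X 2 ^ 5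
      + C β31 * X 0 ^ 3 * X 1 * X 2 ^ 2 + C β23 * X 0 ^ 2 * X 1 ^ 3 * X 2
      + C β02 * X 1 ^ 2 * X 2 ^ 4 : MvPolynomial (Fin 3) K)) = 5 := by
  have hd : !![1, 0, 0; 0, ζ, 0; 0, 0, ζ ^ 2] = Matrix.diagonal ![1, ζ, ζ ^ 2] := by
    ext i j
    fin_cases i <;> fin_cases j <;> rfl
  rw [hd]
  exact planeAut_eq_zpowers_of_preserves_diagonal hsm hord hζ fun u hu =>
    preserves_diagonal_sextic β31 β23 β02 hu
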